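/- arXiv:1411.0998 — 9 statements merged into one kernel-verified Lean document; each statement's English description precedes it below -/
import Mathlib

section
/- Suppose τ > 0 is a dual bound. Let x ∈ S have total constraint violation δ := Σ_{j=1}^k max(Σ_{i=0}^n c_j^{(i)}(x^{(i)}) − b_j, 0) > 0, and define λ' ∈ ℝ^k by λ'_j = 2τ if Σ_{i=0}^n c_j^{(i)}(x^{(i)}) > b_j and λ'_j = 0 otherwise. Then λ' ≥ 0, ‖λ'‖₂ ≤ 2τ√k, and L(x, λ') ≤ OPT − τδ. -/
/-- if `τ > 0` is a dual bound and `x ∈ S` has positive total constraint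
violation `δ`, then the dual vector `λ'` putting weight `2τ` on every violated constraint
is nonnegative, has `ℓ₂`-norm at most `2τ√k`, and satisfies `L(x, λ') ≤ OPT − τδ`. -/
theorem dual_deviation_penalizes_infeasible_point
    (n l k : ℕ) (hn : 1 ≤ n) (hl : 1 ≤ l) (hk : 1 ≤ k)
    (S : Fin (n + 1) → Set (Fin l → ℝ))
    (hSne : ∀ i, (S i).Nonempty) (hScomp : ∀ i, IsCompact (S i))
    (hSconv : ∀ i, Convex ℝ (S i))
    (v : Fin (n + 1) → (Fin l → ℝ) → ℝ)
    (hv : ∀ i, ConcaveOn ℝ (S i) (v i))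
    (c : Fin (n + 1) → Fin k → (Fin l → ℝ) → ℝ)
    (hc : ∀ i j, ConvexOn ℝ (S i) (c i j))
    (b : Fin k → ℝ)
    (OPT : ℝ)
    (hOPT : IsGreatest {z : ℝ | ∃ x : Fin (n + 1) → Fin l → ℝ,
        (∀ i, x i ∈ S i) ∧ (∀ j, ∑ i, c i j (x i) ≤ b j) ∧
        z = ∑ i, v i (x i)} OPT)
    (L : (Fin (n + 1) → Fin l → ℝ) → (Fin k → ℝ) → ℝ)
    (hL : ∀ x lam, L x lam =
        ∑ i, v i (x i) - ∑ j, lam j * (∑ i, c i j (x i) - b j))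
    (τ : ℝ) (hτ : 0 < τ)
    (hdual : ∀ δ : ℝ, 0 ≤ δ → ∀ x : Fin (n + 1) → Fin l → ℝ, (∀ i, x i ∈ S i) →
        (∑ j, max (∑ i, c i j (x i) - b j) 0) ≤ δ →
        ∑ i, v i (x i) ≤ OPT + τ * δ)
    (x : Fin (n + 1) → Fin l → ℝ) (hx : ∀ i, x i ∈ S i)
    (δ : ℝ) (hδ : δ = ∑ j, max (∑ i, c i j (x i) - b j) 0) (hδpos : 0 < δ)
    (lam' : Fin k → ℝ)
    (hlam' : ∀ j, lam' j = if b j < ∑ i, c i j (x i) then 2 * τ else 0) :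
    (∀ j, 0 ≤ lam' j) ∧
    Real.sqrt (∑ j, (lam' j) ^ 2) ≤ 2 * τ * Real.sqrt k ∧
    L x lam' ≤ OPT - τ * δ := by
  have hnonneg : ∀ j, 0 ≤ lam' j := fun j => by
    rw [hlam']
    split_ifs <;> positivity
  have hle : ∀ j, lam' j ≤ 2 * τ := fun j => by
    rw [hlam']
    split_ifs
    · exact le_rfl
    · positivity
  refine ⟨hnonneg, ?_, ?_⟩
  · have hsum : ∑ j, (lam' j) ^ 2 ≤ (2 * τ) ^ 2 * k := by
      calc ∑ j, (lam' j) ^ 2 ≤ ∑ _j : Fin k, (2 * τ) ^ 2 :=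
            Finset.sum_le_sum fun j _ => pow_le_pow_left₀ (hnonneg j) (hle j) 2
        _ = (2 * τ) ^ 2 * k := by simp [mul_comm]
    calc Real.sqrt (∑ j, (lam' j) ^ 2) ≤ Real.sqrt ((2 * τ) ^ 2 * k) := Real.sqrt_le_sqrt hsum
      _ = 2 * τ * Real.sqrt k := by
        rw [Real.sqrt_mul (by positivity), Real.sqrt_sq (by positivity)]
  · have hpenalty : ∑ j, lam' j * (∑ i, c i j (x i) - b j) = 2 * τ * δ := by
      rw [hδ, Finset.mul_sum]
      refine Finset.sum_congr rfl fun j _ => ?_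
      rw [hlam']
      split_ifs with h
      · rw [max_eq_left (by linarith)]
      · rw [max_eq_right (by linarith), zero_mul, mul_zero]
    have hvalue := hdual δ hδpos.le x hx hδ.ge
    rw [hL, hpenalty]
    linarith
end

section
/- Suppose τ > 0 is a dual bound, every v^{(i)} and c_j^{(i)} is continuous on S^{(i)}, and the Lagrangian admits a saddle point (x*, λ*) over S × ℝ^k_{≥0} (i.e., L(x, λ*) ≤ L(x*, λ*) ≤ L(x*, λ) for all x ∈ S and λ ≥ 0). Let Λ = {λ ∈ ℝ^k : λ ≥ 0 and ‖λ‖₂ ≤ 2τ√k}. Then the Lagrangian game restricted to dual strategies Λ has value OPT, i.e., sup_{x∈S} inf_{λ∈Λ} L(x,λ) = inf_{λ∈Λ} sup_{x∈S} L(x,λ) = OPT, and there exists λ• ∈ Λ such that (x*, λ•) is a saddle point of the restricted game: L(x, λ•) ≤ L(x*, λ•) ≤ L(x*, λ) for all x ∈ S and all λ ∈ Λ. -/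
/-- An exact penalty bound with slope `τ` for a convex program yields Lagrange multipliers in
`[0, τ]` that certify the same bound. -/
theorem exists_multiplier_mem_Icc_of_penalty_bound {E ι : Type*} [Fintype ι]
    [TopologicalSpace E] [AddCommGroup E] [Module ℝ E] [IsTopologicalAddGroup E]
    [ContinuousSMul ℝ E] {K : Set E} (hKne : K.Nonempty) (hK : IsCompact K)
    {F : E → ℝ} (hF : ConcaveOn ℝ K F) (hFcont : ContinuousOn F K)
    {g : ι → E → ℝ} (hg : ∀ j, ConvexOn ℝ K (g j)) (hgcont : ∀ j, ContinuousOn (g j) K)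
    {τ M : ℝ} (hτ : 0 ≤ τ) (hbound : ∀ x ∈ K, F x ≤ M + τ * ∑ j, max (g j x) 0) :
    ∃ lam : ι → ℝ, (∀ j, lam j ∈ Set.Icc 0 τ) ∧ ∀ x ∈ K, F x - ∑ j, lam j * g j x ≤ M := by
  have hconcave (lam : ι → ℝ) (hlam : ∀ j, 0 ≤ lam j) :
      ConcaveOn ℝ K fun x ↦ F x - ∑ j, lam j * g j x := by
    refine ⟨hF.1, fun x hx y hy a b ha hb hab ↦ ?_⟩
    have hsum : ∑ j, lam j * g j (a • x + b • y) ≤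
        a * ∑ j, lam j * g j x + b * ∑ j, lam j * g j y := by
      rw [Finset.mul_sum, Finset.mul_sum, ← Finset.sum_add_distrib]
      refine Finset.sum_le_sum fun j _ ↦ ?_
      have := mul_le_mul_of_nonneg_left ((hg j).2 hx hy ha hb hab) (hlam j)
      simp only [smul_eq_mul] at this
      linarith
    have := hF.2 hx hy ha hb hab
    simp only [smul_eq_mul] at this ⊢
    linarith
  have hconvex (x : E) :
      ConvexOn ℝ (Set.univ.pi fun _ : ι ↦ Set.Icc 0 τ) fun lam ↦ F x - ∑ j, lam j * g j x := by
    refine ⟨convex_pi fun _ _ ↦ convex_Icc 0 τ, fun p _ q _ a b _ _ hab ↦ le_of_eq ?_⟩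
    simp only [Pi.add_apply, Pi.smul_apply, smul_eq_mul, mul_sub, Finset.mul_sum, add_mul,
      Finset.sum_add_distrib, mul_assoc]
    linear_combination -(F x) * hab
  obtain ⟨lam, hlam, y, hy, hsaddle⟩ := Sion.exists_isSaddlePointOn
    (X := Set.univ.pi fun _ : ι ↦ Set.Icc 0 τ) (Y := K)
    (f := fun lam x ↦ F x - ∑ j, lam j * g j x)
    ⟨0, fun _ _ ↦ Set.left_mem_Icc.2 hτ⟩ (convex_pi fun _ _ ↦ convex_Icc 0 τ)
    (isCompact_univ_pi fun _ ↦ isCompact_Icc)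
    (fun x _ ↦ ContinuousOn.lowerSemicontinuousOn (by fun_prop))
    (fun x _ ↦ (hconvex x).quasiconvexOn) hF.1 hKne hK
    (fun lam _ ↦ ContinuousOn.upperSemicontinuousOn (by fun_prop))
    (fun lam hlam ↦ (hconcave lam fun j ↦ (hlam j trivial).1).quasiconcaveOn)
  refine ⟨lam, fun j ↦ hlam j trivial, fun x hx ↦ ?_⟩
  have hpenalty : ∑ j, (if 0 ≤ g j y then τ else 0) * g j y = τ * ∑ j, max (g j y) 0 := by
    rw [Finset.mul_sum]
    refine Finset.sum_congr rfl fun j _ ↦ ?_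
    split_ifs with h
    · rw [max_eq_left h]
    · rw [max_eq_right (not_le.1 h).le, zero_mul, mul_zero]
  have hle := hsaddle (fun j ↦ if 0 ≤ g j y then τ else 0)
    (fun j _ ↦ by dsimp only; split_ifs <;> simp [hτ]) x hx
  simp only [hpenalty] at hle
  linarith [hbound y hy]

/-- If `p` is nonnegative coordinatewise and maximizes `⟨·, g⟩` over the nonnegative orthant, then
`g` is nonpositive and complementary to `p`. -/
theorem nonpos_and_complementary_of_dual_optimal {ι : Type*} [Fintype ι] {p g : ι → ℝ}
    (hp : ∀ j, 0 ≤ p j)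
    (hopt : ∀ lam : ι → ℝ, (∀ j, 0 ≤ lam j) → ∑ j, lam j * g j ≤ ∑ j, p j * g j) :
    (∀ j, g j ≤ 0) ∧ ∑ j, p j * g j = 0 := by
  classical
  have hg (j : ι) : g j ≤ 0 := by
    have := hopt (p + Pi.single j 1) 
      (add_nonneg (a := p) hp (Pi.single_nonneg.2 zero_le_one))
    simpa [add_mul, Finset.sum_add_distrib, Pi.single_apply] using this
  refine ⟨hg, le_antisymm ?_ ?_⟩
  · exact Finset.sum_nonpos fun j _ ↦ mul_nonpos_of_nonneg_of_nonpos (hp j) (hg j)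
  · simpa using hopt 0 fun _ ↦ le_rfl

/-- if `τ > 0` is a dual bound, the data is continuous, and the Lagrangian has a
saddle point over `S × ℝ^k_{≥0}`, then the Lagrangian game with dual strategies restricted to
`Λ = {λ ≥ 0 : ‖λ‖₂ ≤ 2τ√k}` has value `OPT`, and there is `λ• ∈ Λ` such that `(x*, λ•)` is a
saddle point of the restricted game. -/
theorem restricted_dual_game_has_value_OPT
    (n l k : ℕ) (hn : 1 ≤ n) (hl : 1 ≤ l) (hk : 1 ≤ k)
    (S : Fin (n + 1) → Set (Fin l → ℝ))
    (hSne : ∀ i, (S i).Nonempty) (hScomp : ∀ i, IsCompact (S i))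
    (hSconv : ∀ i, Convex ℝ (S i))
    (v : Fin (n + 1) → (Fin l → ℝ) → ℝ)
    (hv : ∀ i, ConcaveOn ℝ (S i) (v i))
    (hvcont : ∀ i, ContinuousOn (v i) (S i))
    (c : Fin (n + 1) → Fin k → (Fin l → ℝ) → ℝ)
    (hc : ∀ i j, ConvexOn ℝ (S i) (c i j))
    (hccont : ∀ i j, ContinuousOn (c i j) (S i))
    (b : Fin k → ℝ)
    (OPT : ℝ)
    (hOPT : IsGreatest {z : ℝ | ∃ x : Fin (n + 1) → Fin l → ℝ,
        (∀ i, x i ∈ S i) ∧ (∀ j, ∑ i, c i j (x i) ≤ b j) ∧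
        z = ∑ i, v i (x i)} OPT)
    (L : (Fin (n + 1) → Fin l → ℝ) → (Fin k → ℝ) → ℝ)
    (hL : ∀ x lam, L x lam =
        ∑ i, v i (x i) - ∑ j, lam j * (∑ i, c i j (x i) - b j))
    (τ : ℝ) (hτ : 0 < τ)
    (hdual : ∀ δ : ℝ, 0 ≤ δ → ∀ x : Fin (n + 1) → Fin l → ℝ, (∀ i, x i ∈ S i) →
        (∑ j, max (∑ i, c i j (x i) - b j) 0) ≤ δ →
        ∑ i, v i (x i) ≤ OPT + τ * δ)
    (xstar : Fin (n + 1) → Fin l → ℝ) (lamstar : Fin k → ℝ)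
    (hxstarS : ∀ i, xstar i ∈ S i) (hlamstar : ∀ j, 0 ≤ lamstar j)
    (hsaddle₁ : ∀ x : Fin (n + 1) → Fin l → ℝ, (∀ i, x i ∈ S i) →
        L x lamstar ≤ L xstar lamstar)
    (hsaddle₂ : ∀ lam : Fin k → ℝ, (∀ j, 0 ≤ lam j) →
        L xstar lamstar ≤ L xstar lam)
    (Λ : Set (Fin k → ℝ))
    (hΛ : Λ = {lam : Fin k → ℝ | (∀ j, 0 ≤ lam j) ∧
        Real.sqrt (∑ j, (lam j) ^ 2) ≤ 2 * τ * Real.sqrt k}) :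
    sSup {z : ℝ | ∃ x : Fin (n + 1) → Fin l → ℝ, (∀ i, x i ∈ S i) ∧
        z = sInf {w : ℝ | ∃ lam ∈ Λ, w = L x lam}} = OPT ∧
    sInf {z : ℝ | ∃ lam ∈ Λ,
        z = sSup {w : ℝ | ∃ x : Fin (n + 1) → Fin l → ℝ, (∀ i, x i ∈ S i) ∧ w = L x lam}} = OPT ∧
    ∃ lamB ∈ Λ,
      (∀ x : Fin (n + 1) → Fin l → ℝ, (∀ i, x i ∈ S i) → L x lamB ≤ L xstar lamB) ∧
      (∀ lam ∈ Λ, L xstar lamB ≤ L xstar lam) := by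
  have hKcomp : IsCompact (Set.univ.pi S) := isCompact_univ_pi hScomp
  have hKconv : Convex ℝ (Set.univ.pi S) := convex_pi fun i _ ↦ hSconv i
  have hVcont : ContinuousOn (fun x : Fin (n + 1) → Fin l → ℝ ↦ ∑ i, v i (x i))
      (Set.univ.pi S) :=
    continuousOn_finsetSum _ fun i _ ↦
      (hvcont i).comp (continuous_apply i).continuousOn fun x hx ↦ hx i trivial
  have hCcont (j : Fin k) : ContinuousOn
      (fun x : Fin (n + 1) → Fin l → ℝ ↦ ∑ i, c i j (x i) - b j) (Set.univ.pi S) :=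
    ContinuousOn.sub (continuousOn_finsetSum _ fun i _ ↦
      (hccont i j).comp (continuous_apply i).continuousOn
        fun x (hx : x ∈ Set.univ.pi S) ↦ hx i trivial) continuousOn_const
  have hV : ConcaveOn ℝ (Set.univ.pi S)
      (fun x : Fin (n + 1) → Fin l → ℝ ↦ ∑ i, v i (x i)) := by
    refine ⟨hKconv, fun x hx y hy p q hp hq hpq ↦ ?_⟩
    simp only [smul_eq_mul, Finset.mul_sum, ← Finset.sum_add_distrib]
    exact Finset.sum_le_sum fun i _ ↦ (hv i).2 (hx i trivial) (hy i trivial) hp hq hpq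
  have hC (j : Fin k) : ConvexOn ℝ (Set.univ.pi S)
      (fun x : Fin (n + 1) → Fin l → ℝ ↦ ∑ i, c i j (x i) - b j) := by
    refine ⟨hKconv, fun x hx y hy p q hp hq hpq ↦ ?_⟩
    have : ∑ i, c i j ((p • x + q • y) i) ≤ ∑ i, (p * c i j (x i) + q * c i j (y i)) :=
      Finset.sum_le_sum fun i _ ↦ (hc i j).2 (hx i trivial) (hy i trivial) hp hq hpq
    rw [Finset.sum_add_distrib, ← Finset.mul_sum, ← Finset.mul_sum] at this
    simp only [smul_eq_mul]
    linear_combination this + b j * hpq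
  have hpenalty (x : Fin (n + 1) → Fin l → ℝ) (hx : x ∈ Set.univ.pi S) :
      ∑ i, v i (x i) ≤ OPT + τ * ∑ j, max (∑ i, c i j (x i) - b j) 0 :=
    hdual _ (Finset.sum_nonneg fun j _ ↦ le_max_right _ _) x (fun i ↦ hx i trivial) le_rfl
  obtain ⟨lamB, hlamB, hub⟩ := exists_multiplier_mem_Icc_of_penalty_bound
    (Set.univ_pi_nonempty_iff.2 hSne) hKcomp hV hVcont hC hCcont hτ.le hpenalty
  replace hub (x : Fin (n + 1) → Fin l → ℝ) (hx : ∀ i, x i ∈ S i) : L x lamB ≤ OPT := by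
    rw [hL]
    exact hub x fun i _ ↦ hx i
  have hlamBΛ : lamB ∈ Λ := by
    rw [hΛ]
    refine ⟨fun j ↦ (hlamB j).1, Real.sqrt_le_iff.2 ⟨by positivity, ?_⟩⟩
    calc ∑ j, lamB j ^ 2 ≤ ∑ _j : Fin k, τ ^ 2 :=
          Finset.sum_le_sum fun j _ ↦ pow_le_pow_left₀ (hlamB j).1 (hlamB j).2 2
      _ = τ ^ 2 * k := by simp [mul_comm]
      _ ≤ (2 * τ * Real.sqrt k) ^ 2 := by
          rw [mul_pow, Real.sq_sqrt (Nat.cast_nonneg k)]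
          gcongr
          linarith
  obtain ⟨hfeas, hcompl⟩ := nonpos_and_complementary_of_dual_optimal
    (g := fun j ↦ ∑ i, c i j (xstar i) - b j) hlamstar fun lam hlam ↦ by
      have := hsaddle₂ lam hlam
      rw [hL, hL] at this
      linarith
  have hlb (lam) (hlam : lam ∈ Λ) : OPT ≤ L xstar lam := by
    rw [hΛ] at hlam
    obtain ⟨y, hyS, hyfeas, rfl⟩ := hOPT.1
    have hsaddle := hsaddle₁ y hyS
    rw [hL, hL, hcompl] at hsaddle
    have hy : ∑ j, lamstar j * (∑ i, c i j (y i) - b j) ≤ 0 := Finset.sum_nonpos fun j _ ↦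
      mul_nonpos_of_nonneg_of_nonpos (hlamstar j) (sub_nonpos.2 (hyfeas j))
    have hx : ∑ j, lam j * (∑ i, c i j (xstar i) - b j) ≤ 0 := Finset.sum_nonpos fun j _ ↦
      mul_nonpos_of_nonneg_of_nonpos (hlam.1 j) (hfeas j)
    rw [hL]
    linarith
  have hvalue : L xstar lamB = OPT := (hub xstar hxstarS).antisymm (hlb lamB hlamBΛ)
  have hbelow (x) : BddBelow {w : ℝ | ∃ lam ∈ Λ, w = L x lam} := by
    have hbox : Λ ⊆ Set.Icc 0 fun _ ↦ 2 * τ * Real.sqrt k := by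
      rw [hΛ]
      exact fun lam hlam ↦ ⟨hlam.1, fun j ↦ (Real.le_sqrt_of_sq_le
        (Finset.single_le_sum (f := fun j ↦ lam j ^ 2) (fun i _ ↦ sq_nonneg _)
          (Finset.mem_univ j))).trans hlam.2⟩
    have hcont : Continuous (L x) := by
      rw [funext (hL x)]
      fun_prop
    obtain ⟨m, hm⟩ := (isCompact_Icc.image hcont).bddBelow
    refine ⟨m, ?_⟩
    rintro _ ⟨lam, hlam, rfl⟩
    exact hm ⟨lam, hbox hlam, rfl⟩
  have habove (lam) : BddAbove
      {w : ℝ | ∃ x : Fin (n + 1) → Fin l → ℝ, (∀ i, x i ∈ S i) ∧ w = L x lam} := by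
    have hcont : ContinuousOn (fun x ↦ L x lam) (Set.univ.pi S) := by
      simp only [hL]
      exact hVcont.sub
        (continuousOn_finsetSum _ fun j _ ↦ continuousOn_const.mul (hCcont j))
    refine (hKcomp.image_of_continuousOn hcont).bddAbove.mono ?_
    rintro _ ⟨x, hx, rfl⟩
    exact ⟨x, fun i _ ↦ hx i, rfl⟩
  refine ⟨IsGreatest.csSup_eq ⟨⟨xstar, hxstarS, Eq.symm ?_⟩, ?_⟩,
    IsLeast.csInf_eq ⟨⟨lamB, hlamBΛ, Eq.symm ?_⟩, ?_⟩, lamB, hlamBΛ,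
    fun x hx ↦ hvalue ▸ hub x hx, fun lam hlam ↦ hvalue ▸ hlb lam hlam⟩
  · refine IsLeast.csInf_eq ⟨⟨lamB, hlamBΛ, hvalue.symm⟩, ?_⟩
    rintro _ ⟨lam, hlam, rfl⟩
    exact hlb lam hlam
  · rintro _ ⟨x, hx, rfl⟩
    exact (csInf_le (hbelow x) ⟨lamB, hlamBΛ, rfl⟩).trans (hub x hx)
  · refine IsGreatest.csSup_eq ⟨⟨xstar, hxstarS, hvalue.symm⟩, ?_⟩
    rintro _ ⟨x, hx, rfl⟩
    exact hub x hx
  · rintro _ ⟨lam, hlam, rfl⟩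
    exact (hlb lam hlam).trans (le_csSup (habove lam) ⟨xstar, hxstarS, rfl⟩)
end

section
/- Suppose τ > 0 is a dual bound, let Λ = {λ ∈ ℝ^k : λ ≥ 0 and ‖λ‖_∞ ≤ 2τ}, suppose the Lagrangian game restricted to Λ has value OPT, and let (x̄, λ̄) ∈ S × Λ be an R-approximate minimax equilibrium of the restricted game for some R ≥ 0. Then the total violation of the coupling constraints at x̄ is bounded by Σ_{j=1}^k max(Σ_{i=0}^n c_j^{(i)}(x̄^{(i)}) − b_j, 0) ≤ 2R/τ. -/
/-- if `τ > 0` is a dual bound, the game restricted to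
`Λ = {λ ≥ 0 : ‖λ‖_∞ ≤ 2τ}` has value `OPT`, and `(x̄, λ̄)` is an `R`-approximate minimax
equilibrium of the restricted game, then the total violation of the coupling constraints
at `x̄` is at most `2R/τ`. -/
theorem approx_equilibrium_total_constraint_violation
    (n l k : ℕ) (hn : 1 ≤ n) (hl : 1 ≤ l) (hk : 1 ≤ k)
    (S : Fin (n + 1) → Set (Fin l → ℝ))
    (hSne : ∀ i, (S i).Nonempty) (hScomp : ∀ i, IsCompact (S i))
    (hSconv : ∀ i, Convex ℝ (S i))
    (v : Fin (n + 1) → (Fin l → ℝ) → ℝ)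
    (hv : ∀ i, ConcaveOn ℝ (S i) (v i))
    (c : Fin (n + 1) → Fin k → (Fin l → ℝ) → ℝ)
    (hc : ∀ i j, ConvexOn ℝ (S i) (c i j))
    (b : Fin k → ℝ)
    (OPT : ℝ)
    (hOPT : IsGreatest {z : ℝ | ∃ x : Fin (n + 1) → Fin l → ℝ,
        (∀ i, x i ∈ S i) ∧ (∀ j, ∑ i, c i j (x i) ≤ b j) ∧
        z = ∑ i, v i (x i)} OPT)
    (L : (Fin (n + 1) → Fin l → ℝ) → (Fin k → ℝ) → ℝ)
    (hL : ∀ x lam, L x lam =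
        ∑ i, v i (x i) - ∑ j, lam j * (∑ i, c i j (x i) - b j))
    (τ : ℝ) (hτ : 0 < τ)
    (hdual : ∀ δ : ℝ, 0 ≤ δ → ∀ x : Fin (n + 1) → Fin l → ℝ, (∀ i, x i ∈ S i) →
        (∑ j, max (∑ i, c i j (x i) - b j) 0) ≤ δ →
        ∑ i, v i (x i) ≤ OPT + τ * δ)
    (Λ : Set (Fin k → ℝ))
    (hΛ : Λ = {lam : Fin k → ℝ | (∀ j, 0 ≤ lam j) ∧ ∀ j, lam j ≤ 2 * τ})
    (hvalue₁ : sSup {z : ℝ | ∃ x : Fin (n + 1) → Fin l → ℝ, (∀ i, x i ∈ S i) ∧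
        z = sInf {w : ℝ | ∃ lam ∈ Λ, w = L x lam}} = OPT)
    (hvalue₂ : sInf {z : ℝ | ∃ lam ∈ Λ,
        z = sSup {w : ℝ | ∃ x : Fin (n + 1) → Fin l → ℝ, (∀ i, x i ∈ S i) ∧ w = L x lam}} = OPT)
    (R : ℝ) (hR : 0 ≤ R)
    (xbar : Fin (n + 1) → Fin l → ℝ) (lambar : Fin k → ℝ)
    (hxbarS : ∀ i, xbar i ∈ S i) (hlambar : lambar ∈ Λ)
    (heq₁ : ∀ x : Fin (n + 1) → Fin l → ℝ, (∀ i, x i ∈ S i) →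
        L x lambar - R ≤ L xbar lambar)
    (heq₂ : ∀ lam ∈ Λ, L xbar lambar ≤ L xbar lam + R) :
    ∑ j, max (∑ i, c i j (xbar i) - b j) 0 ≤ 2 * R / τ := by
  obtain ⟨⟨x, hxS, hxb, hx⟩, -⟩ := hOPT
  subst hΛ
  have hlow : OPT ≤ L x lambar := by
    have hsum : ∑ j, lambar j * (∑ i, c i j (x i) - b j) ≤ 0 :=
      Finset.sum_nonpos fun j _ =>
        mul_nonpos_of_nonneg_of_nonpos (hlambar.1 j) (sub_nonpos.2 (hxb j))
    rw [hL, hx]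
    linarith
  have hupp := hdual _ (Finset.sum_nonneg fun j _ => le_max_right _ _) xbar hxbarS le_rfl
  have hpen : L xbar (fun j => if 0 ≤ ∑ i, c i j (xbar i) - b j then 2 * τ else 0) =
      ∑ i, v i (xbar i) - 2 * τ * ∑ j, max (∑ i, c i j (xbar i) - b j) 0 := by
    rw [hL, Finset.mul_sum]
    congr 1
    refine Finset.sum_congr rfl fun j _ => ?_
    split_ifs with h
    · rw [max_eq_left h]
    · rw [max_eq_right (not_le.1 h).le, zero_mul, mul_zero]
  have hdev := heq₂ (fun j => if 0 ≤ ∑ i, c i j (xbar i) - b j then 2 * τ else 0)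
    ⟨fun j => by dsimp only; split_ifs <;> linarith,
      fun j => by dsimp only; split_ifs <;> linarith⟩
  have hbest := heq₁ x hxS
  rw [le_div_iff₀ hτ]
  linarith
end

section
/- Suppose τ > 0 is a dual bound, let Λ = {λ ∈ ℝ^k : λ ≥ 0 and ‖λ‖_∞ ≤ 2τ}, suppose the Lagrangian game restricted to Λ has value OPT, and let (x̄, λ̄) ∈ S × Λ be an R-approximate minimax equilibrium of the restricted game for some R ≥ 0. Then the objective value at x̄ satisfies Σ_{i=0}^n v^{(i)}(x̄^{(i)}) ≥ OPT − 2R. -/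
/-- if `τ > 0` is a dual bound, the game restricted to
`Λ = {λ ≥ 0 : ‖λ‖_∞ ≤ 2τ}` has value `OPT`, and `(x̄, λ̄)` is an `R`-approximate minimax
equilibrium of the restricted game, then the objective value at `x̄` is at least `OPT − 2R`. -/
theorem approx_equilibrium_objective_value
    (n l k : ℕ) (hn : 1 ≤ n) (hl : 1 ≤ l) (hk : 1 ≤ k)
    (S : Fin (n + 1) → Set (Fin l → ℝ))
    (hSne : ∀ i, (S i).Nonempty) (hScomp : ∀ i, IsCompact (S i))
    (hSconv : ∀ i, Convex ℝ (S i))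
    (v : Fin (n + 1) → (Fin l → ℝ) → ℝ)
    (hv : ∀ i, ConcaveOn ℝ (S i) (v i))
    (c : Fin (n + 1) → Fin k → (Fin l → ℝ) → ℝ)
    (hc : ∀ i j, ConvexOn ℝ (S i) (c i j))
    (b : Fin k → ℝ)
    (OPT : ℝ)
    (hOPT : IsGreatest {z : ℝ | ∃ x : Fin (n + 1) → Fin l → ℝ,
        (∀ i, x i ∈ S i) ∧ (∀ j, ∑ i, c i j (x i) ≤ b j) ∧
        z = ∑ i, v i (x i)} OPT)
    (L : (Fin (n + 1) → Fin l → ℝ) → (Fin k → ℝ) → ℝ)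
    (hL : ∀ x lam, L x lam =
        ∑ i, v i (x i) - ∑ j, lam j * (∑ i, c i j (x i) - b j))
    (τ : ℝ) (hτ : 0 < τ)
    (hdual : ∀ δ : ℝ, 0 ≤ δ → ∀ x : Fin (n + 1) → Fin l → ℝ, (∀ i, x i ∈ S i) →
        (∑ j, max (∑ i, c i j (x i) - b j) 0) ≤ δ →
        ∑ i, v i (x i) ≤ OPT + τ * δ)
    (Λ : Set (Fin k → ℝ))
    (hΛ : Λ = {lam : Fin k → ℝ | (∀ j, 0 ≤ lam j) ∧ ∀ j, lam j ≤ 2 * τ})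
    (hvalue₁ : sSup {z : ℝ | ∃ x : Fin (n + 1) → Fin l → ℝ, (∀ i, x i ∈ S i) ∧
        z = sInf {w : ℝ | ∃ lam ∈ Λ, w = L x lam}} = OPT)
    (hvalue₂ : sInf {z : ℝ | ∃ lam ∈ Λ,
        z = sSup {w : ℝ | ∃ x : Fin (n + 1) → Fin l → ℝ, (∀ i, x i ∈ S i) ∧ w = L x lam}} = OPT)
    (R : ℝ) (hR : 0 ≤ R)
    (xbar : Fin (n + 1) → Fin l → ℝ) (lambar : Fin k → ℝ)
    (hxbarS : ∀ i, xbar i ∈ S i) (hlambar : lambar ∈ Λ)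
    (heq₁ : ∀ x : Fin (n + 1) → Fin l → ℝ, (∀ i, x i ∈ S i) →
        L x lambar - R ≤ L xbar lambar)
    (heq₂ : ∀ lam ∈ Λ, L xbar lambar ≤ L xbar lam + R) :
    OPT - 2 * R ≤ ∑ i, v i (xbar i) := by
  subst hΛ
  obtain ⟨⟨x, hxS, hxfeas, hxOPT⟩, -⟩ := hOPT
  have hopt_le : OPT ≤ L x lambar := by
    have hpenalty : ∑ j, lambar j * (∑ i, c i j (x i) - b j) ≤ 0 :=
      Finset.sum_nonpos fun j _ =>
        mul_nonpos_of_nonneg_of_nonpos (hlambar.1 j) (sub_nonpos.2 (hxfeas j))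
    rw [hL, hxOPT]
    linarith
  have hzero : L xbar lambar ≤ L xbar 0 + R :=
    heq₂ 0 ⟨fun _ => le_rfl, fun _ => by simp [hτ.le]⟩
  have hLzero : L xbar 0 = ∑ i, v i (xbar i) := by simp [hL]
  linarith [heq₁ x hxS]
end

section
/- Let λ̄ ∈ ℝ^k with λ̄ ≥ 0, let R ≥ 0 and α > 0, and let x̄ ∈ S satisfy L(x̄, λ̄) ≥ sup_{x∈S} L(x, λ̄) − R (i.e., x̄ is an R-approximate best response of the primal player to λ̄). Then the number of agents i ∈ {0,1,…,n} that are not α-satisfied at x̄^{(i)} with respect to λ̄ is at most R/α. -/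
/-- If `x` maximises a separable sum over the product of the sets `S i` up to an error `R`, then at
most `R / α` coordinates can be improved individually by more than `α`. -/
theorem ncard_improvable_le_div {ι E : Type*} [Fintype ι] (S : ι → Set E) (g : ι → E → ℝ)
    {R α : ℝ} (hα : 0 < α) (x : ι → E) (hx : ∀ i, x i ∈ S i)
    (hmax : ∀ y : ι → E, (∀ i, y i ∈ S i) → ∑ i, g i (y i) - R ≤ ∑ i, g i (x i)) :
    ({i | ¬ ∀ y ∈ S i, g i y - α ≤ g i (x i)}.ncard : ℝ) ≤ R / α := by
  classical
  have himp : ∀ i, ∃ y ∈ S i,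
      (if ¬ ∀ y ∈ S i, g i y - α ≤ g i (x i) then α else 0) ≤ g i y - g i (x i) := by
    intro i
    split_ifs with h
    · exact ⟨x i, hx i, by simp⟩
    · push Not at h
      obtain ⟨y, hy, hlt⟩ := h
      exact ⟨y, hy, by linarith⟩
  choose y hyS hy using himp
  have hsum := Finset.sum_le_sum fun i (_ : i ∈ Finset.univ) => hy i
  rw [← Finset.sum_filter, Finset.sum_const, nsmul_eq_mul, Finset.sum_sub_distrib] at hsum
  rw [le_div_iff₀ hα, Set.ncard_eq_toFinset_card', Set.toFinset_ofPred]
  linarith [hmax y hyS]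

/-- A Lagrangian of a separable program is the sum of the agents' individual Lagrangians and a
constant. -/
theorem sum_sub_sum_mul_sum_sub {ι κ : Type*} [Fintype ι] [Fintype κ]
    (v : ι → ℝ) (c : ι → κ → ℝ) (b lam : κ → ℝ) :
    ∑ i, v i - ∑ j, lam j * (∑ i, c i j - b j) =
      ∑ i, (v i - ∑ j, lam j * c i j) + ∑ j, lam j * b j := by
  simp only [mul_sub, Finset.sum_sub_distrib, Finset.mul_sum]
  rw [Finset.sum_comm]
  ring


/-- if `x̄ ∈ S` is an `R`-approximate best response of the primal player to
prices `λ̄ ≥ 0`, then at most `R/α` agents fail to be `α`-satisfied at `x̄^{(i)}`. -/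
theorem few_unsatisfied_agents
    (n l k : ℕ) (hn : 1 ≤ n) (hl : 1 ≤ l) (hk : 1 ≤ k)
    (S : Fin (n + 1) → Set (Fin l → ℝ))
    (hSne : ∀ i, (S i).Nonempty) (hScomp : ∀ i, IsCompact (S i))
    (hSconv : ∀ i, Convex ℝ (S i))
    (v : Fin (n + 1) → (Fin l → ℝ) → ℝ)
    (hv : ∀ i, ConcaveOn ℝ (S i) (v i))
    (c : Fin (n + 1) → Fin k → (Fin l → ℝ) → ℝ)
    (hc : ∀ i j, ConvexOn ℝ (S i) (c i j))
    (b : Fin k → ℝ)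
    (L : (Fin (n + 1) → Fin l → ℝ) → (Fin k → ℝ) → ℝ)
    (hL : ∀ x lam, L x lam =
        ∑ i, v i (x i) - ∑ j, lam j * (∑ i, c i j (x i) - b j))
    (lambar : Fin k → ℝ) (hlambar : ∀ j, 0 ≤ lambar j)
    (R α : ℝ) (hR : 0 ≤ R) (hα : 0 < α)
    (xbar : Fin (n + 1) → Fin l → ℝ) (hxbarS : ∀ i, xbar i ∈ S i)
    (hbr : ∀ x : Fin (n + 1) → Fin l → ℝ, (∀ i, x i ∈ S i) →
        L x lambar - R ≤ L xbar lambar) :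
    (({i : Fin (n + 1) |
        ¬ (∀ y ∈ S i, v i y - ∑ j, lambar j * c i j y - α ≤
            v i (xbar i) - ∑ j, lambar j * c i j (xbar i))}).ncard : ℝ)
      ≤ R / α := by
  refine ncard_improvable_le_div S (fun i y => v i y - ∑ j, lambar j * c i j y) hα xbar hxbarS
    fun x hx => ?_
  have h := hbr x hx
  rw [hL, hL, sum_sub_sum_mul_sum_sub, sum_sub_sum_mul_sum_sub] at h
  linarith
end

section
/- Suppose additionally that for every agent i and every x ∈ S^{(i)}: 0 ≤ v^{(i)}(x) ≤ V, c_j^{(i)}(x) ≥ 0 for all j, Σ_{j=1}^k c_j^{(i)}(x) ≤ C₁, and S^{(i)} contains a null action. Suppose τ > 0 is a dual bound, Λ = {λ ∈ ℝ^k : λ ≥ 0 and ‖λ‖_∞ ≤ 2τ}, the Lagrangian game restricted to Λ has value OPT, and (x̄, λ̄) ∈ S × Λ is an R-approximate minimax equilibrium of the restricted game, with R ≥ 0 and α > 0. Define x̃ ∈ S by: x̃^{(i)} = x̄^{(i)} if agent i is α-satisfied at x̄^{(i)} with respect to λ̄, and otherwise x̃^{(i)} is any point attaining sup_{x∈S^{(i)}}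 (v^{(i)}(x) − Σ_j λ̄_j c_j^{(i)}(x)). Then: (a) every agent i is α-satisfied at x̃^{(i)} with respect to λ̄; (b) for every j, Σ_{i=0}^n c_j^{(i)}(x̃^{(i)}) − b_j ≤ R(2/τ + C₁/α); and (c) Σ_{i=0}^n v^{(i)}(x̃^{(i)}) ≥ OPT − R(2 + V/α). -/
/-- The Lagrangian of a separable program splits into the agents' utilities and a price term. -/
lemma sum_sub_sum_mul_sub_eq {ι κ : Type*} [Fintype ι] [Fintype κ]
    (w : ι → ℝ) (d : ι → κ → ℝ) (lam b : κ → ℝ) :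
    ∑ i, w i - ∑ j, lam j * (∑ i, d i j - b j) =
      ∑ i, (w i - ∑ j, lam j * d i j) + ∑ j, lam j * b j := by
  have hswap : ∑ i, ∑ j, lam j * d i j = ∑ j, lam j * ∑ i, d i j := by
    rw [Finset.sum_comm]
    simp only [Finset.mul_sum]
  simp only [mul_sub, Finset.sum_sub_distrib, hswap]
  ring

/-- If `f` exceeds `g` by at most `B` on `U` and not at all off `U`, then the sum of `f` exceeds
that of `g` by at most `B` times the size of `U`. -/
lemma sum_le_sum_add_card_mul {ι : Type*} [Fintype ι] (U : Finset ι) (f g : ι → ℝ) (B : ℝ)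
    (hU : ∀ i ∈ U, f i ≤ g i + B) (hUc : ∀ i ∉ U, f i ≤ g i) :
    ∑ i, f i ≤ ∑ i, g i + U.card * B := by
  classical
  have hle : ∑ i, f i ≤ ∑ i, (g i + if i ∈ U then B else 0) := by
    refine Finset.sum_le_sum fun i _ => ?_
    by_cases hi : i ∈ U
    · simpa [hi] using hU i hi
    · simpa [hi] using hUc i hi
  simpa [Finset.sum_add_distrib] using hle


/-- reassigning the unsatisfied agents of an `R`-approximate equilibrium
`(x̄, λ̄)` to their utility-maximizing points (at prices `λ̄`) yields a point `x̃` at which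
(a) every agent is `α`-satisfied, (b) every coupling constraint is violated by at most
`R(2/τ + C₁/α)`, and (c) the welfare is at least `OPT − R(2 + V/α)`. -/
theorem truedude_reassignment_guarantees
    (n l k : ℕ) (hn : 1 ≤ n) (hl : 1 ≤ l) (hk : 1 ≤ k)
    (S : Fin (n + 1) → Set (Fin l → ℝ))
    (hSne : ∀ i, (S i).Nonempty) (hScomp : ∀ i, IsCompact (S i))
    (hSconv : ∀ i, Convex ℝ (S i))
    (v : Fin (n + 1) → (Fin l → ℝ) → ℝ)
    (hv : ∀ i, ConcaveOn ℝ (S i) (v i))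
    (c : Fin (n + 1) → Fin k → (Fin l → ℝ) → ℝ)
    (hc : ∀ i j, ConvexOn ℝ (S i) (c i j))
    (b : Fin k → ℝ)
    (V C₁ : ℝ)
    (hvbd : ∀ i, ∀ x ∈ S i, 0 ≤ v i x ∧ v i x ≤ V)
    (hcnonneg : ∀ i j, ∀ x ∈ S i, 0 ≤ c i j x)
    (hcbd : ∀ i, ∀ x ∈ S i, ∑ j, c i j x ≤ C₁)
    (hnull : ∀ i, ∃ x₀ ∈ S i, v i x₀ = 0 ∧ ∀ j, c i j x₀ = 0)
    (OPT : ℝ)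
    (hOPT : IsGreatest {z : ℝ | ∃ x : Fin (n + 1) → Fin l → ℝ,
        (∀ i, x i ∈ S i) ∧ (∀ j, ∑ i, c i j (x i) ≤ b j) ∧
        z = ∑ i, v i (x i)} OPT)
    (L : (Fin (n + 1) → Fin l → ℝ) → (Fin k → ℝ) → ℝ)
    (hL : ∀ x lam, L x lam =
        ∑ i, v i (x i) - ∑ j, lam j * (∑ i, c i j (x i) - b j))
    (τ : ℝ) (hτ : 0 < τ)
    (hdual : ∀ δ : ℝ, 0 ≤ δ → ∀ x : Fin (n + 1) → Fin l → ℝ, (∀ i, x i ∈ S i) →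
        (∑ j, max (∑ i, c i j (x i) - b j) 0) ≤ δ →
        ∑ i, v i (x i) ≤ OPT + τ * δ)
    (Λ : Set (Fin k → ℝ))
    (hΛ : Λ = {lam : Fin k → ℝ | (∀ j, 0 ≤ lam j) ∧ ∀ j, lam j ≤ 2 * τ})
    (hvalue₁ : sSup {z : ℝ | ∃ x : Fin (n + 1) → Fin l → ℝ, (∀ i, x i ∈ S i) ∧
        z = sInf {w : ℝ | ∃ lam ∈ Λ, w = L x lam}} = OPT)
    (hvalue₂ : sInf {z : ℝ | ∃ lam ∈ Λ,
        z = sSup {w : ℝ | ∃ x : Fin (n + 1) → Fin l → ℝ, (∀ i, x i ∈ S i) ∧ w = L x lam}} = OPT)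
    (R α : ℝ) (hR : 0 ≤ R) (hα : 0 < α)
    (xbar : Fin (n + 1) → Fin l → ℝ) (lambar : Fin k → ℝ)
    (hxbarS : ∀ i, xbar i ∈ S i) (hlambar : lambar ∈ Λ)
    (heq₁ : ∀ x : Fin (n + 1) → Fin l → ℝ, (∀ i, x i ∈ S i) →
        L x lambar - R ≤ L xbar lambar)
    (heq₂ : ∀ lam ∈ Λ, L xbar lambar ≤ L xbar lam + R)
    (xt : Fin (n + 1) → Fin l → ℝ)
    (hxt_sat : ∀ i,
        (∀ y ∈ S i, v i y - ∑ j, lambar j * c i j y - α ≤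
            v i (xbar i) - ∑ j, lambar j * c i j (xbar i)) →
        xt i = xbar i)
    (hxt_unsat : ∀ i,
        ¬ (∀ y ∈ S i, v i y - ∑ j, lambar j * c i j y - α ≤
            v i (xbar i) - ∑ j, lambar j * c i j (xbar i)) →
        xt i ∈ S i ∧
        ∀ y ∈ S i, v i y - ∑ j, lambar j * c i j y ≤
            v i (xt i) - ∑ j, lambar j * c i j (xt i)) :
    (∀ i, xt i ∈ S i ∧
        ∀ y ∈ S i, v i y - ∑ j, lambar j * c i j y - α ≤
            v i (xt i) - ∑ j, lambar j * c i j (xt i)) ∧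
    (∀ j, ∑ i, c i j (xt i) - b j ≤ R * (2 / τ + C₁ / α)) ∧
    (OPT - R * (2 + V / α) ≤ ∑ i, v i (xt i)) := by
  classical
  have hlam := hlambar
  rw [hΛ] at hlam
  let U : Finset (Fin (n + 1)) := Finset.univ.filter fun i =>
    ¬ (∀ y ∈ S i, v i y - ∑ j, lambar j * c i j y - α ≤
      v i (xbar i) - ∑ j, lambar j * c i j (xbar i))
  have hxt_eq : ∀ i ∉ U, xt i = xbar i := fun i hi => hxt_sat i (by simpa [U] using hi)
  have hxt_max : ∀ i ∈ U, xt i ∈ S i ∧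
      ∀ y ∈ S i, v i y - ∑ j, lambar j * c i j y ≤
        v i (xt i) - ∑ j, lambar j * c i j (xt i) :=
    fun i hi => hxt_unsat i (Finset.mem_filter.1 hi).2
  have hxtS : ∀ i, xt i ∈ S i := by
    intro i
    by_cases hi : i ∈ U
    · exact (hxt_max i hi).1
    · exact hxt_eq i hi ▸ hxbarS i
  have hcard : (U.card : ℝ) ≤ R / α := by
    rw [le_div_iff₀ hα]
    have hgain := sum_le_sum_add_card_mul U
      (fun i => v i (xbar i) - ∑ j, lambar j * c i j (xbar i))
      (fun i => v i (xt i) - ∑ j, lambar j * c i j (xt i)) (-α)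
      (fun i hi => by
        have hunsat := (Finset.mem_filter.1 hi).2
        push Not at hunsat
        obtain ⟨y, hy, hlt⟩ := hunsat
        linarith [(hxt_max i hi).2 y hy])
      (fun i hi => by simp only [hxt_eq i hi, le_refl])
    have hequil := heq₁ xt hxtS
    rw [hL, hL, sum_sub_sum_mul_sub_eq (fun i => v i (xt i)) (fun i j => c i j (xt i)),
      sum_sub_sum_mul_sub_eq (fun i => v i (xbar i)) (fun i j => c i j (xbar i))] at hequil
    linarith
  have hbar : OPT - R ≤ L xbar lambar := by
    obtain ⟨x, hxS, hfeas, rfl⟩ := hOPT.1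
    have hneg : ∑ j, lambar j * (∑ i, c i j (x i) - b j) ≤ 0 :=
      Finset.sum_nonpos fun j _ =>
        mul_nonpos_of_nonneg_of_nonpos (hlam.1 j) (sub_nonpos.2 (hfeas j))
    have hequil := heq₁ x hxS
    rw [hL x] at hequil
    linarith
  set δ := ∑ j, max (∑ i, c i j (xbar i) - b j) 0 with hδ
  have hδ0 : 0 ≤ δ := Finset.sum_nonneg fun j _ => le_max_right _ _
  have hwelfare : OPT - 2 * R + 2 * τ * δ ≤ ∑ i, v i (xbar i) := by
    have hpen := hbar.trans <| heq₂ (fun j => if 0 ≤ ∑ i, c i j (xbar i) - b j then 2 * τ else 0) (by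
      rw [hΛ]
      constructor <;> intro j <;> dsimp only <;> split_ifs <;> linarith)
    have hpay : ∑ j, (if 0 ≤ ∑ i, c i j (xbar i) - b j then 2 * τ else 0) *
        (∑ i, c i j (xbar i) - b j) = 2 * τ * δ := by
      rw [hδ, Finset.mul_sum]
      refine Finset.sum_congr rfl fun j _ => ?_
      split_ifs with h
      · rw [max_eq_left h]
      · rw [max_eq_right (not_le.1 h).le, zero_mul, mul_zero]
    rw [hL, hpay] at hpen
    linarith
  have hδR : δ ≤ 2 * R / τ := by
    rw [le_div_iff₀ hτ]
    linarith [hdual δ hδ0 xbar hxbarS le_rfl]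
  have hC₁ : 0 ≤ C₁ :=
    (Finset.sum_nonneg fun j _ => hcnonneg 0 j _ (hxbarS 0)).trans (hcbd 0 _ (hxbarS 0))
  have hV : 0 ≤ V := (hvbd 0 _ (hxbarS 0)).1.trans (hvbd 0 _ (hxbarS 0)).2
  refine ⟨fun i => ⟨hxtS i, fun y hy => ?_⟩, fun j => ?_, ?_⟩
  · by_cases hi : i ∈ U
    · linarith [(hxt_max i hi).2 y hy]
    · rw [hxt_eq i hi]
      have hsat := hi
      simp only [U, Finset.mem_filter, Finset.mem_univ, true_and, not_not] at hsat
      exact hsat y hy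
  · have hload := sum_le_sum_add_card_mul U (fun i => c i j (xt i)) (fun i => c i j (xbar i)) C₁
      (fun i _ => by
        have hle : c i j (xt i) ≤ ∑ j, c i j (xt i) :=
          Finset.single_le_sum (fun j _ => hcnonneg i j _ (hxtS i)) (Finset.mem_univ j)
        linarith [hcbd i _ (hxtS i), hcnonneg i j _ (hxbarS i)])
      (fun i hi => by rw [hxt_eq i hi])
    have hviol : ∑ i, c i j (xbar i) - b j ≤ δ :=
      (le_max_left _ _).trans (Finset.single_le_sum
        (f := fun j => max (∑ i, c i j (xbar i) - b j) 0)
        (fun j _ => le_max_right _ _) (Finset.mem_univ j))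
    have hbound : R * (2 / τ + C₁ / α) = 2 * R / τ + R / α * C₁ := by ring
    linarith [mul_le_mul_of_nonneg_right hcard hC₁]
  · have hloss := sum_le_sum_add_card_mul U (fun i => v i (xbar i)) (fun i => v i (xt i)) V
      (fun i _ => by linarith [(hvbd i _ (hxbarS i)).2, (hvbd i _ (hxtS i)).1])
      (fun i hi => by rw [hxt_eq i hi])
    have hbound : R * (2 + V / α) = 2 * R + R / α * V := by ring
    linarith [mul_le_mul_of_nonneg_right hcard hV, mul_nonneg hτ.le hδ0]
end

section
/- Let B > 0, ε ≥ 0, δ ≥ 0, and let μ and ν be Borel probability measures on ℝ that are supported on the interval [0, B]. Suppose that for every Borel set S ⊆ ℝ, μ(S) ≤ e^ε·ν(S) + δ. Then ∫ x dμ(x) ≤ e^ε·∫ x dν(x) + δ·B. -/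
open MeasureTheory

lemma ae_mem_Icc_of_compl_null {B : ℝ} {μ : Measure ℝ}
    (h : μ (Set.Icc (0 : ℝ) B)ᶜ = 0) : ∀ᵐ x ∂μ, x ∈ Set.Icc (0 : ℝ) B :=
  h

lemma integrable_id_of_compl_Icc_null {B : ℝ} {μ : Measure ℝ} [IsFiniteMeasure μ]
    (h : μ (Set.Icc (0 : ℝ) B)ᶜ = 0) : Integrable (fun x : ℝ => x) μ :=
  Integrable.of_mem_Icc 0 B aemeasurable_id (ae_mem_Icc_of_compl_null h)

lemma integral_id_eq_integral_Ioc_real_Ici {B : ℝ} {μ : Measure ℝ} [IsFiniteMeasure μ]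
    (h : μ (Set.Icc (0 : ℝ) B)ᶜ = 0) :
    ∫ x, x ∂μ = ∫ t in Set.Ioc 0 B, μ.real (Set.Ici t) :=
  (integrable_id_of_compl_Icc_null h).integral_eq_integral_Ioc_meas_le
    ((ae_mem_Icc_of_compl_null h).mono fun _ hx => hx.1)
    ((ae_mem_Icc_of_compl_null h).mono fun _ hx => hx.2)

lemma integrableOn_real_Ici (B : ℝ) (μ : Measure ℝ) [IsFiniteMeasure μ] :
    IntegrableOn (fun t => μ.real (Set.Ici t)) (Set.Ioc 0 B) := by
  have hanti : Antitone fun t : ℝ => μ.real (Set.Ici t) :=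
    fun _ _ hst => measureReal_mono (Set.Ici_subset_Ici.2 hst)
  exact ((hanti.antitoneOn _).integrableOn_isCompact isCompact_Icc).mono_set
    Set.Ioc_subset_Icc_self

/-- if two Borel probability measures on `ℝ` supported on `[0, B]` satisfy
`μ(S) ≤ e^ε·ν(S) + δ` for every Borel set `S`, then their expectations satisfy
`∫ x dμ ≤ e^ε·∫ x dν + δ·B`. -/
theorem dp_expectation_bound
    (B ε δ : ℝ) (hB : 0 < B) (hε : 0 ≤ ε) (hδ : 0 ≤ δ)
    (μ ν : Measure ℝ) [IsProbabilityMeasure μ] [IsProbabilityMeasure ν]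
    (hμsupp : μ (Set.Icc (0 : ℝ) B)ᶜ = 0)
    (hνsupp : ν (Set.Icc (0 : ℝ) B)ᶜ = 0)
    (hdp : ∀ S : Set ℝ, MeasurableSet S →
        μ S ≤ ENNReal.ofReal (Real.exp ε) * ν S + ENNReal.ofReal δ) :
    ∫ x, x ∂μ ≤ Real.exp ε * ∫ x, x ∂ν + δ * B := by
  have hreal (t : ℝ) : μ.real (Set.Ici t) ≤ Real.exp ε * ν.real (Set.Ici t) + δ := by
    refine ENNReal.toReal_le_of_le_ofReal (by positivity) ?_
    rw [ENNReal.ofReal_add (by positivity) hδ, ENNReal.ofReal_mul (Real.exp_pos ε).le,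
      ofReal_measureReal]
    exact hdp _ measurableSet_Ici
  have hν : IntegrableOn (fun t => Real.exp ε * ν.real (Set.Ici t)) (Set.Ioc 0 B) :=
    (integrableOn_real_Ici B ν).const_mul _
  have hconst : IntegrableOn (fun _ : ℝ => δ) (Set.Ioc 0 B) :=
    integrableOn_const measure_Ioc_lt_top.ne
  calc ∫ x, x ∂μ = ∫ t in Set.Ioc 0 B, μ.real (Set.Ici t) :=
        integral_id_eq_integral_Ioc_real_Ici hμsupp
    _ ≤ ∫ t in Set.Ioc 0 B, (Real.exp ε * ν.real (Set.Ici t) + δ) :=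
        integral_mono (integrableOn_real_Ici B μ) (hν.add hconst) hreal
    _ = Real.exp ε * ∫ x, x ∂ν + δ * B := by
        rw [integral_add hν hconst, integral_const_mul,
          ← integral_id_eq_integral_Ioc_real_Ici hνsupp, setIntegral_const,
          Real.volume_real_Ioc_of_le hB.le, smul_eq_mul, sub_zero, mul_comm B]
end

section
/- Let X ⊆ ℝ^n and Y ⊆ ℝ^m be nonempty compact convex sets, and let A : ℝ^n × ℝ^m → ℝ be continuous, concave in its first argument on X for each fixed y ∈ Y, and convex in its second argument on Y for each fixed x ∈ X. Let T ≥ 1, let y_1,…,y_T ∈ Y, and for each t let x_t ∈ X attain max_{x∈X} A(x, y_t). Define the minimization player's regret R = (1/T) Σ_{t=1}^T A(x_t, y_t) − min_{y∈Y} (1/T) Σ_{t=1}^T A(x_t, y), and let x̄ = (1/T) Σ_{t=1}^T x_t and ȳ = (1/T) Σ_{t=1}^T y_t. Then (x̄, ȳ) is an R-approximate minimax equilibrium: A(x̄, ȳ) ≥ max_{x∈X} A(x, ȳ) − R and A(x̄, ȳ) ≤ min_{y∈Y} A(x̄, y) + R. -/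
/-- The average of finitely many points of a convex set belongs to it. -/
lemma Convex.inv_smul_sum_mem {E : Type*} [AddCommGroup E] [Module ℝ E] {s : Set E}
    (hs : Convex ℝ s) {T : ℕ} (hT : 1 ≤ T) {p : Fin T → E} (hp : ∀ t, p t ∈ s) :
    (T : ℝ)⁻¹ • ∑ t, p t ∈ s := by
  have hT' : (T : ℝ) ≠ 0 := by positivity
  rw [Finset.smul_sum]
  exact hs.sum_mem (fun _ _ => by positivity) (by simp [hT']) fun t _ => hp t

/-- Jensen's inequality for the uniform average of finitely many points. -/
lemma ConvexOn.map_inv_smul_sum_le {E : Type*} [AddCommGroup E] [Module ℝ E] {s : Set E}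
    {f : E → ℝ} (hf : ConvexOn ℝ s f) {T : ℕ} (hT : 1 ≤ T) {p : Fin T → E}
    (hp : ∀ t, p t ∈ s) :
    f ((T : ℝ)⁻¹ • ∑ t, p t) ≤ 1 / (T : ℝ) * ∑ t, f (p t) := by
  have hT' : (T : ℝ) ≠ 0 := by positivity
  rw [Finset.smul_sum, one_div, Finset.mul_sum]
  exact hf.map_sum_le (fun _ _ => by positivity) (by simp [hT']) fun t _ => hp t

/-- Jensen's inequality for the uniform average of finitely many points, concave version. -/
lemma ConcaveOn.le_map_inv_smul_sum {E : Type*} [AddCommGroup E] [Module ℝ E] {s : Set E}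
    {f : E → ℝ} (hf : ConcaveOn ℝ s f) {T : ℕ} (hT : 1 ≤ T) {p : Fin T → E}
    (hp : ∀ t, p t ∈ s) :
    1 / (T : ℝ) * ∑ t, f (p t) ≤ f ((T : ℝ)⁻¹ • ∑ t, p t) := by
  have hT' : (T : ℝ) ≠ 0 := by positivity
  rw [Finset.smul_sum, one_div, Finset.mul_sum]
  exact hf.le_map_sum (fun _ _ => by positivity) (by simp [hT']) fun t _ => hp t

/-- Freund–Schapire: in a concave–convex zero-sum game, if the max player
best responds to the min player's plays `y_1, …, y_T`, then the averages `(x̄, ȳ)` form an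
`R`-approximate minimax equilibrium, where `R` is the min player's regret. -/
theorem no_regret_dynamics_approx_equilibrium
    (n m : ℕ)
    (X : Set (EuclideanSpace ℝ (Fin n))) (Y : Set (EuclideanSpace ℝ (Fin m)))
    (hXne : X.Nonempty) (hXcomp : IsCompact X) (hXconv : Convex ℝ X)
    (hYne : Y.Nonempty) (hYcomp : IsCompact Y) (hYconv : Convex ℝ Y)
    (A : EuclideanSpace ℝ (Fin n) → EuclideanSpace ℝ (Fin m) → ℝ)
    (hAcont : Continuous
        (fun q : EuclideanSpace ℝ (Fin n) × EuclideanSpace ℝ (Fin m) => A q.1 q.2))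
    (hAconc : ∀ y ∈ Y, ConcaveOn ℝ X (fun x => A x y))
    (hAconv : ∀ x ∈ X, ConvexOn ℝ Y (fun y => A x y))
    (T : ℕ) (hT : 1 ≤ T)
    (y : Fin T → EuclideanSpace ℝ (Fin m)) (hy : ∀ t, y t ∈ Y)
    (x : Fin T → EuclideanSpace ℝ (Fin n))
    (hxmem : ∀ t, x t ∈ X)
    (hxbr : ∀ t, ∀ x' ∈ X, A x' (y t) ≤ A (x t) (y t))
    (mval : ℝ)
    (hmval : IsLeast {w : ℝ | ∃ y' ∈ Y, w = (1 / (T : ℝ)) * ∑ t, A (x t) y'} mval)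
    (R : ℝ) (hR : R = (1 / (T : ℝ)) * ∑ t, A (x t) (y t) - mval)
    (xbar : EuclideanSpace ℝ (Fin n)) (hxbar : xbar = (T : ℝ)⁻¹ • ∑ t, x t)
    (ybar : EuclideanSpace ℝ (Fin m)) (hybar : ybar = (T : ℝ)⁻¹ • ∑ t, y t) :
    (∀ x' ∈ X, A x' ybar - R ≤ A xbar ybar) ∧
    (∀ y' ∈ Y, A xbar ybar ≤ A xbar y' + R) := by
  have hxbarX : xbar ∈ X := hxbar ▸ hXconv.inv_smul_sum_mem hT hxmem
  have hybarY : ybar ∈ Y := hybar ▸ hYconv.inv_smul_sum_mem hT hy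
  have hlower : ∀ y' ∈ Y, mval ≤ A xbar y' := fun y' hy' => by
    rw [hxbar]
    exact (hmval.2 ⟨y', hy', rfl⟩).trans ((hAconc y' hy').le_map_inv_smul_sum hT hxmem)
  have hupper : ∀ x' ∈ X, A x' ybar ≤ mval + R := fun x' hx' => by
    rw [hR, add_sub_cancel, hybar]
    refine ((hAconv x' hx').map_inv_smul_sum_le hT hy).trans ?_
    gcongr with t
    exact hxbr t x' hx'
  exact ⟨fun x' hx' => by linarith [hupper x' hx', hlower ybar hybarY],
    fun y' hy' => by linarith [hupper xbar hxbarX, hlower y' hy']⟩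
end

section
/- Let P ⊆ ℝ^k be a nonempty compact convex set containing 0, with D = max_{p∈P} ‖p‖₂, and let Π_P denote Euclidean projection onto P (the unique nearest point of P). Let T ≥ 1, η > 0, and let x_1,…,x_T ∈ ℝ^k satisfy ‖x_t‖₂ ≤ G for all t. Define the projected gradient descent iterates p_1 = 0 and p_{t+1} = Π_P(p_t − η·x_t) for t = 1,…,T−1. Then the regret satisfies (1/T) Σ_{t=1}^T ⟨p_t, x_t⟩ − min_{p∈P} (1/T) Σ_{t=1}^T ⟨p, x_t⟩ ≤ D²/(2ηT) + η·G²/2. -/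
/-- A nearest point `v` of a convex set to `u` is at least as close as `u` to each point of the
set. -/
theorem Convex.norm_sub_le_of_forall_norm_sub_le {E : Type*} [NormedAddCommGroup E]
    [InnerProductSpace ℝ E] {K : Set E} (hK : Convex ℝ K) {u v q : E} (hv : v ∈ K)
    (hmin : ∀ w ∈ K, ‖v - u‖ ≤ ‖w - u‖) (hq : q ∈ K) : ‖v - q‖ ≤ ‖u - q‖ := by
  have : Nonempty K := ⟨⟨v, hv⟩⟩
  have hinf : ‖u - v‖ = ⨅ w : K, ‖u - w‖ := by
    refine le_antisymm (le_ciInf fun w => ?_) ?_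
    · rw [norm_sub_rev u v, norm_sub_rev u w]
      exact hmin w w.2
    · exact ciInf_le (f := fun w : K => ‖u - w‖)
        ⟨0, by rintro _ ⟨w, rfl⟩; exact norm_nonneg _⟩ ⟨v, hv⟩
  have hinner := (norm_eq_iInf_iff_real_inner_le_zero hK hv).1 hinf q hq
  have hexp := norm_sub_sq_real (u - v) (q - v)
  rw [sub_sub_sub_cancel_right] at hexp
  rw [norm_sub_rev v q]
  refine le_of_sq_le_sq ?_ (norm_nonneg _)
  nlinarith [sq_nonneg ‖u - v‖]

/-- The potential bound for projected gradient descent: the cumulative regret against `q` plus the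
squared distance from `q` to the last unprojected iterate. -/
theorem sum_inner_add_norm_sq_le_of_projected_descent {E : Type*} [NormedAddCommGroup E]
    [InnerProductSpace ℝ E] {η G : ℝ} {p x : ℕ → E} {q : E} {n : ℕ} (hn : 1 ≤ n)
    (hx : ∀ t, ‖x t‖ ≤ G)
    (hstep : ∀ t, 1 ≤ t → t < n → ‖p (t + 1) - q‖ ≤ ‖p t - η • x t - q‖) :
    2 * η * ∑ t ∈ Finset.Icc 1 n, inner ℝ (p t - q) (x t) + ‖p n - η • x n - q‖ ^ 2
      ≤ ‖p 1 - q‖ ^ 2 + n * (η ^ 2 * G ^ 2) := by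
  have hdescent (t : ℕ) : 2 * η * inner ℝ (p t - q) (x t) + ‖p t - η • x t - q‖ ^ 2
      ≤ ‖p t - q‖ ^ 2 + η ^ 2 * G ^ 2 := by
    have hexp := norm_sub_sq_real (p t - q) (η • x t)
    rw [sub_right_comm, inner_smul_right, norm_smul, mul_pow, Real.norm_eq_abs, sq_abs] at hexp
    have hG : ‖x t‖ ^ 2 ≤ G ^ 2 := pow_le_pow_left₀ (norm_nonneg _) (hx t) 2
    have := mul_le_mul_of_nonneg_left hG (sq_nonneg η)
    linarith
  induction n, hn using Nat.le_induction with
  | base => simpa using hdescent 1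
  | succ n hn ih =>
    have hprev := ih fun t h1 ht => hstep t h1 (ht.trans n.lt_succ_self)
    have hproj := pow_le_pow_left₀ (norm_nonneg _) (hstep n hn n.lt_succ_self) 2
    rw [Finset.sum_Icc_succ_top (by omega), mul_add]
    push_cast
    linarith [hdescent (n + 1)]

/-- Zinkevich: projected online gradient descent over a compact convex set
`P ∋ 0` with step size `η` against loss vectors of norm at most `G` has average regret at
most `D²/(2ηT) + ηG²/2`, where `D = max_{p∈P} ‖p‖₂`. -/
theorem online_gradient_descent_regret
    (k : ℕ) (P : Set (EuclideanSpace ℝ (Fin k)))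
    (hPne : P.Nonempty) (hPcomp : IsCompact P) (hPconv : Convex ℝ P)
    (hP0 : (0 : EuclideanSpace ℝ (Fin k)) ∈ P)
    (D : ℝ) (hD : IsGreatest ((fun p => ‖p‖) '' P) D)
    (proj : EuclideanSpace ℝ (Fin k) → EuclideanSpace ℝ (Fin k))
    (hproj : ∀ y, proj y ∈ P ∧ ∀ q ∈ P, ‖proj y - y‖ ≤ ‖q - y‖)
    (T : ℕ) (hT : 1 ≤ T) (η : ℝ) (hη : 0 < η)
    (G : ℝ)
    (x : ℕ → EuclideanSpace ℝ (Fin k)) (hx : ∀ t, ‖x t‖ ≤ G)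
    (p : ℕ → EuclideanSpace ℝ (Fin k))
    (hp1 : p 1 = 0)
    (hrec : ∀ t : ℕ, 1 ≤ t → t ≤ T - 1 → p (t + 1) = proj (p t - η • x t)) :
    (1 / (T : ℝ)) * ∑ t ∈ Finset.Icc 1 T, ∑ i, p t i * x t i
        - sInf {w : ℝ | ∃ q ∈ P,
            w = (1 / (T : ℝ)) * ∑ t ∈ Finset.Icc 1 T, ∑ i, q i * x t i}
      ≤ D ^ 2 / (2 * η * T) + η * G ^ 2 / 2 := by
  have hT0 : (0 : ℝ) < T := by exact_mod_cast hT
  have hinner (u v : EuclideanSpace ℝ (Fin k)) : ∑ i, u i * v i = inner ℝ u v := by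
    simp [PiLp.inner_apply, mul_comm]
  simp only [hinner]
  rw [sub_le_comm]
  refine le_csInf ⟨_, 0, hP0, rfl⟩ ?_
  rintro _ ⟨q, hq, rfl⟩
  have hpot := sum_inner_add_norm_sq_le_of_projected_descent (η := η) (p := p) (q := q) hT hx
    fun t h1 ht => by
      rw [hrec t h1 (by omega)]
      exact hPconv.norm_sub_le_of_forall_norm_sub_le (hproj _).1 (hproj _).2 hq
  rw [hp1, zero_sub, norm_neg] at hpot
  have hqD : ‖q‖ ^ 2 ≤ D ^ 2 := pow_le_pow_left₀ (norm_nonneg _) (hD.2 ⟨q, hq, rfl⟩) 2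
  simp only [inner_sub_left, Finset.sum_sub_distrib] at hpot
  rw [sub_le_comm, ← mul_sub]
  have hbound : D ^ 2 / (2 * η * T) + η * G ^ 2 / 2
      = 1 / T * ((D ^ 2 + T * (η ^ 2 * G ^ 2)) / (2 * η)) := by
    field_simp
  rw [hbound]
  refine mul_le_mul_of_nonneg_left ?_ (by positivity)
  rw [le_div_iff₀ (by positivity)]
  linarith [sq_nonneg ‖p T - η • x T - q‖]
end
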